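/- Suppose the multi-commodity system satisfies, at every feasible point q, both the block strict diagonal dominance condition σ_min(J_{ℓ,ℓ}) > Σ_{p≠ℓ} σ_max(J_{p,ℓ}) for every commodity block ℓ of the Jacobian of f, and the M-matrix condition (∂g_{ij}^{(ℓ)}/∂q_i^{(ℓ)} > 0, ∂g_{ij}^{(ℓ)}/∂q_j^{(ℓ)} < 0 for every edge and commodity, ∂g_{iT}^{(ℓ)}/∂q_i^{(ℓ)} ≥ 0 for all i with strict inequality for at least one i). Suppose furthermore there exist finite reals b̲_i^{(ℓ)} ≤ b̄_i^{(ℓ)} such that on the box B̄ = Π_{i,ℓ}[b̲_i^{(ℓ)}, b̄_i^{(ℓ)}] one has f_i^{(ℓ)}(q) ≤ 0 whenever q_i^{(ℓ)} = b̄_i^{(ℓ)} and f_i^{(ℓ)}(q) ≥ 0 whenever q_i^{(ℓ)} = b̲_i^{(ℓ)}. Then the system has exactly one equilibrium point; it lies in B̄, and every eigenvalue of the Jacobian there has strictly negative real part. (This is the paper's Theorem 5.) -/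

import Mathlib

/-- The smallest singular value `σ_min(M) = sqrt(λ_min(M Mᵀ))`, with
`λ_min(M Mᵀ)` the smallest eigenvalue (real root of the characteristic
polynomial) of the positive semidefinite symmetric matrix `M Mᵀ`. -/
noncomputable def sigmaMin {m n : Type*} [Fintype m] [Fintype n] [DecidableEq m]
    (M : Matrix m n ℝ) : ℝ :=
  Real.sqrt (sInf {r : ℝ | (M * M.transpose).charpoly.IsRoot r})

/-- The largest singular value `σ_max(M) = sqrt(λ_max(Mᵀ M))`. -/
noncomputable def sigmaMax {m n : Type*} [Fintype m] [Fintype n] [DecidableEq n]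
    (M : Matrix m n ℝ) : ℝ :=
  Real.sqrt (sSup {r : ℝ | (M.transpose * M).charpoly.IsRoot r})

/-- A multi-commodity network system: a finite directed acyclic graph on
`Fin N` with edge set `E`, `C` commodities, per-commodity buffer sizes
`b i ℓ ∈ (0,∞]`, nonnegative arrival rates `lam i ℓ`, `C¹` policies
`g i j ℓ` depending on the commodity queue vectors at nodes `i` and `j`, and
`C¹` departure functions `gT i ℓ` depending on the commodity queue vector at
node `i`.  The state is a vector `q : Fin N × Fin C → ℝ`, with `q (i, ℓ)`
the queue length of commodity `ℓ` at node `i`. -/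
structure MultiCommoditySystem (N C : ℕ) where
  E : Finset (Fin N × Fin N)
  no_self_loops : ∀ e ∈ E, e.1 ≠ e.2
  antisymm : ∀ i u : Fin N, (i, u) ∈ E → (u, i) ∉ E
  acyclic : ∃ rank : Fin N → ℕ, ∀ e ∈ E, rank e.1 < rank e.2
  b : Fin N → Fin C → EReal
  b_pos : ∀ i ℓ, 0 < b i ℓ
  lam : Fin N → Fin C → ℝ
  lam_nonneg : ∀ i ℓ, 0 ≤ lam i ℓ
  g : Fin N → Fin N → Fin C → (Fin C → ℝ) → (Fin C → ℝ) → ℝ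
  gT : Fin N → Fin C → (Fin C → ℝ) → ℝ
  g_contDiff : ∀ e ∈ E, ∀ ℓ,
    ContDiff ℝ 1 (fun x : (Fin C → ℝ) × (Fin C → ℝ) => g e.1 e.2 ℓ x.1 x.2)
  gT_contDiff : ∀ i ℓ, ContDiff ℝ 1 (gT i ℓ)

namespace MultiCommoditySystem

variable {N C : ℕ} (S : MultiCommoditySystem N C)

/-- Feasibility: `0 ≤ q i ℓ ≤ b i ℓ` for every node `i` and commodity `ℓ`. -/
def Feasible (q : Fin N × Fin C → ℝ) : Prop :=
  ∀ i ℓ, 0 ≤ q (i, ℓ) ∧ (q (i, ℓ) : EReal) ≤ S.b i ℓ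

/-- The dynamics `f i ℓ (q) = lam i ℓ + Σ_{k:(k,i)∈E} g k i ℓ
− Σ_{j:(i,j)∈E} g i j ℓ − gT i ℓ`. -/
noncomputable def f (q : Fin N × Fin C → ℝ) (i : Fin N) (ℓ : Fin C) : ℝ :=
  S.lam i ℓ
    + ∑ k ∈ Finset.univ.filter fun k => (k, i) ∈ S.E,
        S.g k i ℓ (fun c => q (k, c)) (fun c => q (i, c))
    - ∑ j ∈ Finset.univ.filter fun j => (i, j) ∈ S.E,
        S.g i j ℓ (fun c => q (i, c)) (fun c => q (j, c))
    - S.gT i ℓ (fun c => q (i, c))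

/-- The Jacobian of the dynamics at `q`: entry `((i,p),(j,ℓ))` is the
partial derivative of `f i p` with respect to the queue variable `q (j, ℓ)`. -/
noncomputable def jacobian (q : Fin N × Fin C → ℝ) :
    Matrix (Fin N × Fin C) (Fin N × Fin C) ℝ :=
  fun a v => deriv (fun x => S.f (Function.update q v x) a.1 a.2) (q v)

/-- The `(p,ℓ)` commodity block of the Jacobian: the partial derivatives of
the commodity-`p` dynamics with respect to the commodity-`ℓ` queue variables. -/
noncomputable def block (q : Fin N × Fin C → ℝ) (p ℓ : Fin C) :
    Matrix (Fin N) (Fin N) ℝ :=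
  Matrix.of fun i j => S.jacobian q (i, p) (j, ℓ)

/-- Block strict diagonal dominance (in the ℓ2 sense) of the Jacobian at `q`:
`σ_min(J_{ℓ,ℓ}) > Σ_{p≠ℓ} σ_max(J_{p,ℓ})` for every commodity `ℓ`. -/
def BlockDiagDominant (q : Fin N × Fin C → ℝ) : Prop :=
  ∀ ℓ, ∑ p ∈ Finset.univ.erase ℓ, sigmaMax (S.block q p ℓ) < sigmaMin (S.block q ℓ ℓ)

/-- The M-matrix (sign) condition at `q`: for every commodity `ℓ`,
`∂g_{ij}^{(ℓ)}/∂q_i^{(ℓ)} > 0` and `∂g_{ij}^{(ℓ)}/∂q_j^{(ℓ)} < 0` for every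
edge `(i,j) ∈ E`, `∂gT_i^{(ℓ)}/∂q_i^{(ℓ)} ≥ 0` for every node `i`, and
`∂gT_i^{(ℓ)}/∂q_i^{(ℓ)} > 0` for at least one node `i`. -/
def MMatrixCond (q : Fin N × Fin C → ℝ) : Prop :=
  ∀ ℓ : Fin C,
    (∀ e ∈ S.E,
      0 < deriv (fun x => S.g e.1 e.2 ℓ
            (Function.update (fun c => q (e.1, c)) ℓ x) (fun c => q (e.2, c)))
          (q (e.1, ℓ)) ∧
      deriv (fun y => S.g e.1 e.2 ℓ
            (fun c => q (e.1, c)) (Function.update (fun c => q (e.2, c)) ℓ y))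
          (q (e.2, ℓ)) < 0) ∧
    (∀ i, 0 ≤ deriv (fun x => S.gT i ℓ (Function.update (fun c => q (i, c)) ℓ x))
          (q (i, ℓ))) ∧
    (∃ i, 0 < deriv (fun x => S.gT i ℓ (Function.update (fun c => q (i, c)) ℓ x))
          (q (i, ℓ)))

end MultiCommoditySystem

open Matrix in
lemma aux_root_of_eig {n : Type*} [Fintype n] [DecidableEq n] (H : Matrix n n ℝ) (r : ℝ)
    (x : n → ℝ) (hx : x ≠ 0) (h : H *ᵥ x = r • x) : H.charpoly.IsRoot r := by
  rw [Polynomial.IsRoot, Matrix.eval_charpoly]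
  apply Matrix.exists_mulVec_eq_zero_iff.1
  refine ⟨x, hx, ?_⟩
  rw [Matrix.sub_mulVec, h]
  ext i
  simp [Matrix.scalar_apply]

open Matrix in
lemma aux_rayleigh {n : Type*} [Fintype n] [DecidableEq n] (H : Matrix n n ℝ) (hH : H.IsHermitian)
    (c : ℝ) (hc : ∀ r, H.charpoly.IsRoot r → c ≤ r) (x : n → ℝ) :
    c * (x ⬝ᵥ x) ≤ x ⬝ᵥ (H *ᵥ x) := by
  have hK : (H - Matrix.scalar n c).IsHermitian := by
    apply hH.sub
    simp [Matrix.IsHermitian, Matrix.scalar_apply]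
  have hps : (H - Matrix.scalar n c).PosSemidef := by
    rw [hK.posSemidef_iff_eigenvalues_nonneg]
    intro i
    have he := hK.mulVec_eigenvectorBasis i
    have hr : H.charpoly.IsRoot (hK.eigenvalues i + c) := by
      apply aux_root_of_eig H _ (WithLp.ofLp (hK.eigenvectorBasis i))
      · intro h0
        have := hK.eigenvectorBasis.orthonormal.ne_zero i
        apply this
        ext j
        simpa using congrFun h0 j
      · rw [Matrix.sub_mulVec] at he
        rw [add_smul, ← he]
        ext j
        simp [Matrix.scalar_apply]
    have := hc _ hr
    simp only [Pi.zero_apply]; linarith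
  have := hps.dotProduct_mulVec_nonneg x
  rw [Matrix.sub_mulVec, dotProduct_sub] at this
  have h2 : (Matrix.scalar n c) *ᵥ x = c • x := by
    ext j; simp [Matrix.scalar_apply, Matrix.mulVec_diagonal]
  rw [h2, dotProduct_smul] at this
  simp at this
  linarith

lemma aux_roots_finite {n : Type*} [Fintype n] [DecidableEq n] (H : Matrix n n ℝ) :
    {r : ℝ | H.charpoly.IsRoot r}.Finite := 
  Polynomial.finite_setOfPred_isRoot (H.charpoly_monic.ne_zero)

open Matrix in
lemma aux_dot {n : Type*} [Fintype n] (M : Matrix n n ℝ) (x : n → ℝ) :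
    x ⬝ᵥ ((Mᵀ * M) *ᵥ x) = ∑ i, (M *ᵥ x) i ^ 2 := by
  rw [← Matrix.mulVec_mulVec, Matrix.dotProduct_mulVec, Matrix.vecMul_transpose]
  simp [dotProduct, sq]

open Matrix in
lemma sigmaMin_sq_le {n : Type*} [Fintype n] [DecidableEq n] (M : Matrix n n ℝ) (x : n → ℝ) :
    sigmaMin M ^ 2 * ∑ i, x i ^ 2 ≤ ∑ i, (M *ᵥ x) i ^ 2 := by
  unfold sigmaMin
  rw [Matrix.charpoly_mul_comm]
  set c := sInf {r : ℝ | (Mᵀ * M).charpoly.IsRoot r} with hc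
  rcases le_total c 0 with h | h
  · rw [Real.sqrt_eq_zero_of_nonpos h]
    simp only [ne_eq, OfNat.ofNat_ne_zero, not_false_eq_true, zero_pow, zero_mul]
    positivity
  · rw [Real.sq_sqrt h]
    have := aux_rayleigh (Mᵀ * M) (by simpa using Matrix.isHermitian_conjTranspose_mul_self M) c
      (fun r hr => csInf_le (aux_roots_finite _).bddBelow hr) x
    rw [aux_dot] at this
    simpa [dotProduct, sq] using this

open Matrix in
lemma sigmaMax_sq_le {n : Type*} [Fintype n] [DecidableEq n] (M : Matrix n n ℝ) (x : n → ℝ) :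
    ∑ i, (M *ᵥ x) i ^ 2 ≤ sigmaMax M ^ 2 * ∑ i, x i ^ 2 := by
  unfold sigmaMax
  set c := sSup {r : ℝ | (Mᵀ * M).charpoly.IsRoot r} with hc
  have hh : (Mᵀ * M).IsHermitian := by simpa using Matrix.isHermitian_conjTranspose_mul_self M
  have := aux_rayleigh (-(Mᵀ * M)) hh.neg (-c)
      (fun r hr => by
        have : (Mᵀ * M).charpoly.IsRoot (-r) := by
          rw [Polynomial.IsRoot, Matrix.eval_charpoly] at hr ⊢
          obtain ⟨v, hv, h⟩ := Matrix.exists_mulVec_eq_zero_iff.2 hr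
          apply Matrix.exists_mulVec_eq_zero_iff.1
          refine ⟨v, hv, ?_⟩
          rw [← neg_eq_zero, ← Matrix.neg_mulVec, ← h]
          congr 1
          rw [map_neg]
          abel
        have := le_csSup (aux_roots_finite _).bddAbove this
        linarith) x
  rw [Matrix.neg_mulVec, dotProduct_neg, aux_dot] at this
  have h1 : ∑ i, (M *ᵥ x) i ^ 2 ≤ c * ∑ i, x i ^ 2 := by
    have h3 : x ⬝ᵥ x = ∑ i, x i ^ 2 := by simp [dotProduct, sq]
    rw [h3] at this
    linarith
  have h2 : c ≤ Real.sqrt c ^ 2 := by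
    rcases le_total c 0 with h | h
    · exact h.trans (sq_nonneg _)
    · rw [Real.sq_sqrt h]
  exact h1.trans (mul_le_mul_of_nonneg_right h2 (by positivity))

/-- Complex version of the bound by the largest singular value. -/
lemma sigmaMax_norm_le {n : Type*} [Fintype n] [DecidableEq n] (M : Matrix n n ℝ) (x : n → ℂ) :
    ‖(WithLp.toLp 2 (fun i => ∑ j, (M i j : ℂ) * x j) : EuclideanSpace ℂ n)‖
      ≤ sigmaMax M * ‖(WithLp.toLp 2 x : EuclideanSpace ℂ n)‖ := by
  have h0 : 0 ≤ sigmaMax M := Real.sqrt_nonneg _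
  apply le_of_sq_le_sq _ (by positivity)
  rw [mul_pow, EuclideanSpace.norm_sq_eq, EuclideanSpace.norm_sq_eq]
  have hr := sigmaMax_sq_le M (fun i => (x i).re)
  have hi := sigmaMax_sq_le M (fun i => (x i).im)
  simp only [← Complex.normSq_eq_norm_sq, Complex.normSq_apply, ← sq, Complex.re_sum, Complex.im_sum,
    Complex.re_ofReal_mul, Complex.im_ofReal_mul, Finset.sum_add_distrib]
  simp only [Matrix.mulVec, dotProduct] at hr hi
  linarith

/-- A nonsingular, weakly column diagonally dominant Z-matrix `-J` is inverse positive. -/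
lemma aux_inv_pos {n : Type*} [Fintype n] [DecidableEq n] (J : Matrix n n ℝ)
    (hoff : ∀ i j, i ≠ j → 0 ≤ J i j) (hcol : ∀ j, ∑ i, J i j ≤ 0)
    (hinj : ∀ x : n → ℝ, J.mulVec x = 0 → x = 0)
    (x : n → ℝ) (hx : ∀ i, J.mulVec x i ≤ 0) : ∀ i, 0 ≤ x i := by
  set w : n → ℝ := fun i => max (-x i) 0 with hw
  have hw0 : ∀ i, 0 ≤ w i := fun i => le_max_right _ _
  have h1 : ∀ i, 0 ≤ J.mulVec w i := by
    intro i
    by_cases hi : x i < 0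
    · have h2 : 0 ≤ J.mulVec w i + J.mulVec x i := by
        simp only [Matrix.mulVec, dotProduct]
        rw [← Finset.sum_add_distrib]
        apply Finset.sum_nonneg
        intro j _
        rw [← mul_add]
        by_cases hij : i = j
        · subst hij
          have : w i + x i = 0 := by
            simp only [hw]; rw [max_eq_left (by linarith)]; ring
          rw [this]; simp
        · have : 0 ≤ w j + x j := by
            have := le_max_left (-x j) 0
            simp only [hw]; linarith
          exact mul_nonneg (hoff i j hij) this
      linarith [hx i]
    · simp only [Matrix.mulVec, dotProduct]
      apply Finset.sum_nonneg
      intro j _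
      by_cases hij : i = j
      · subst hij
        have : w i = 0 := by simp only [hw]; exact max_eq_right (by linarith)
        rw [this]; simp
      · exact mul_nonneg (hoff i j hij) (hw0 j)
  have h2 : ∑ i, J.mulVec w i ≤ 0 := by
    simp only [Matrix.mulVec, dotProduct]
    rw [Finset.sum_comm]
    apply Finset.sum_nonpos
    intro j _
    rw [← Finset.sum_mul]
    exact mul_nonpos_of_nonpos_of_nonneg (hcol j) (hw0 j)
  have h3 : ∑ i, J.mulVec w i = 0 := le_antisymm h2 (Finset.sum_nonneg fun i _ => h1 i)
  have h4 := (Finset.sum_eq_zero_iff_of_nonneg (fun i _ => h1 i)).1 h3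
  have h5 : w = 0 := hinj w (by ext i; exact h4 i (Finset.mem_univ i))
  intro i
  have := congrFun h5 i
  have h6 := le_max_left (-x i) 0
  simp only [hw, Pi.zero_apply] at this
  linarith

/-- Comparison estimate for the smallest singular value. -/
lemma aux_compare {n : Type*} [Fintype n] [DecidableEq n] (J : Matrix n n ℝ)
    (hoff : ∀ i j, i ≠ j → 0 ≤ J i j) (hcol : ∀ j, ∑ i, J i j ≤ 0)
    (hs : 0 < sigmaMin J) (u y : EuclideanSpace ℂ n)
    (h : ∀ i, - ∑ j, J i j * ‖u j‖ ≤ ‖y i‖) :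
    sigmaMin J * ‖u‖ ≤ ‖y‖ := by
  have hinj : ∀ x : n → ℝ, J.mulVec x = 0 → x = 0 := by
    intro x hx
    have h1 := sigmaMin_sq_le J x
    rw [hx] at h1
    simp only [Pi.zero_apply] at h1
    have h2 : ∑ i, x i ^ 2 ≤ 0 := by
      have : 0 < sigmaMin J ^ 2 := by positivity
      by_contra hc
      push Not at hc
      have := mul_pos this hc
      simp at h1
      linarith
    have h3 : ∑ i, x i ^ 2 = 0 := le_antisymm h2 (by positivity)
    have h4 := (Finset.sum_eq_zero_iff_of_nonneg (fun i _ => sq_nonneg (x i))).1 h3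
    ext i
    simpa using h4 i (Finset.mem_univ i)
  have hinj' : Function.Injective J.mulVecLin := by
    rw [injective_iff_map_eq_zero]
    exact fun x hx => hinj x (by simpa using hx)
  have hsurj := LinearMap.surjective_of_injective hinj'
  obtain ⟨x, hx⟩ := hsurj (fun i => - ‖y i‖)
  rw [Matrix.mulVecLin_apply] at hx
  have hpos := aux_inv_pos J hoff hcol hinj (x - fun i => ‖u i‖) (by
    intro i
    rw [Matrix.mulVec_sub, hx]
    have := h i
    simp only [Pi.sub_apply, Matrix.mulVec, dotProduct]
    linarith)
  have h1 := sigmaMin_sq_le J x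
  rw [hx] at h1
  apply le_of_sq_le_sq _ (norm_nonneg _)
  rw [mul_pow, EuclideanSpace.norm_sq_eq, EuclideanSpace.norm_sq_eq]
  simp only [even_two, Even.neg_pow] at h1
  refine le_trans ?_ h1
  apply mul_le_mul_of_nonneg_left _ (sq_nonneg _)
  apply Finset.sum_le_sum
  intro i _
  have := hpos i
  simp only [Pi.sub_apply] at this
  exact pow_le_pow_left₀ (norm_nonneg _) (by linarith) 2


/-- Poincaré–Miranda for functions with the (negative) P-property. -/
lemma aux_exists {ι : Type*} [Fintype ι] [DecidableEq ι] (F : (ι → ℝ) → ι → ℝ)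
    (hF : Continuous F) (bl bu : ι → ℝ) (hle : ∀ v, bl v ≤ bu v)
    (hup : ∀ v, ∀ q ∈ Set.Icc bl bu, q v = bu v → F q v ≤ 0)
    (hlo : ∀ v, ∀ q ∈ Set.Icc bl bu, q v = bl v → 0 ≤ F q v)
    (hP : ∀ x ∈ Set.Icc bl bu, ∀ y ∈ Set.Icc bl bu, x ≠ y →
      ∃ i, (x i - y i) * (F x i - F y i) < 0) (T : Finset ι) :
    ∀ p ∈ Set.Icc bl bu, ∃ z ∈ Set.Icc bl bu, (∀ i, i ∉ T → z i = p i) ∧ ∀ i ∈ T, F z i = 0 := by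
  induction T using Finset.induction_on with
  | empty => exact fun p hp => ⟨p, hp, fun _ _ => rfl, by simp⟩
  | insert v T hv ih =>
    intro p hp
    set Γ : Set (ι → ℝ) := {z | z ∈ Set.Icc bl bu ∧ (∀ i, i ∉ insert v T → z i = p i) ∧
      ∀ i ∈ T, F z i = 0} with hΓ
    have hFi : ∀ i, Continuous fun z => F z i := fun i => (continuous_apply i).comp hF
    have hΓc : IsCompact Γ := by
      have hcl : IsClosed {z : ι → ℝ | (∀ i, i ∉ insert v T → z i = p i) ∧ ∀ i ∈ T, F z i = 0} := by
        simp only [Set.ofPred_and, Set.ofPred_forall]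
        apply IsClosed.inter
        · exact isClosed_iInter fun i => isClosed_iInter fun _ =>
            isClosed_eq (continuous_apply i) continuous_const
        · exact isClosed_iInter fun i => isClosed_iInter fun _ =>
            isClosed_eq (hFi i) continuous_const
      exact (isCompact_Icc (a := bl) (b := bu)).inter_right hcl
    have hex : ∀ t ∈ Set.Icc (bl v) (bu v), ∃ z ∈ Γ, z v = t := by
      intro t ht
      obtain ⟨z, hz, h1, h2⟩ := ih (Function.update p v t) (by
        constructor
        · intro i
          by_cases hi : i = v
          · subst hi; simpa using ht.1
          · simpa [hi] using hp.1 i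
        · intro i
          by_cases hi : i = v
          · subst hi; simpa using ht.2
          · simpa [hi] using hp.2 i)
      refine ⟨z, ⟨hz, ?_, h2⟩, ?_⟩
      · intro i hi
        rw [Finset.mem_insert, not_or] at hi
        rw [h1 i hi.2, Function.update_of_ne hi.1]
      · rw [h1 v hv, Function.update_self]
    have huniq : ∀ z ∈ Γ, ∀ z' ∈ Γ, z v = z' v → z = z' := by
      intro z hz z' hz' h
      by_contra hne
      obtain ⟨i, hi⟩ := hP z hz.1 z' hz'.1 hne
      by_cases hiT : i ∈ T
      · rw [hz.2.2 i hiT, hz'.2.2 i hiT] at hi; simp at hi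
      · by_cases hiv : i = v
        · subst hiv; rw [h] at hi; simp at hi
        · rw [hz.2.1 i (by simp [hiT, hiv]), hz'.2.1 i (by simp [hiT, hiv])] at hi; simp at hi
    have hpos : IsClosed ((fun z : ι → ℝ => z v) '' (Γ ∩ {z | 0 ≤ F z v})) :=
      ((hΓc.inter_right (isClosed_le continuous_const (hFi v))).image (continuous_apply v)).isClosed
    have hneg : IsClosed ((fun z : ι → ℝ => z v) '' (Γ ∩ {z | F z v ≤ 0})) :=
      ((hΓc.inter_right (isClosed_le (hFi v) continuous_const)).image (continuous_apply v)).isClosed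
    have hconn := isPreconnected_closed_iff.1 (isPreconnected_Icc (a := bl v) (b := bu v)) _ _
      hpos hneg
      (by
        intro t ht
        obtain ⟨z, hz, rfl⟩ := hex t ht
        rcases le_total 0 (F z v) with h | h
        · exact Or.inl ⟨z, ⟨hz, h⟩, rfl⟩
        · exact Or.inr ⟨z, ⟨hz, h⟩, rfl⟩)
      (by
        obtain ⟨z, hz, h⟩ := hex (bl v) ⟨le_rfl, hle v⟩
        exact ⟨bl v, ⟨le_rfl, hle v⟩, z, ⟨hz, hlo v z hz.1 h⟩, h⟩)
      (by
        obtain ⟨z, hz, h⟩ := hex (bu v) ⟨hle v, le_rfl⟩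
        exact ⟨bu v, ⟨hle v, le_rfl⟩, z, ⟨hz, hup v z hz.1 h⟩, h⟩)
    obtain ⟨t, _, ⟨z, ⟨hz, hzp⟩, hzt⟩, ⟨z', ⟨hz', hzn⟩, hzt'⟩⟩ := hconn
    have heq := huniq z hz z' hz' (hzt.trans hzt'.symm)
    subst heq
    refine ⟨z, hz.1, hz.2.1, ?_⟩
    intro i hi
    rcases Finset.mem_insert.1 hi with rfl | hi
    · exact le_antisymm hzn hzp
    · exact hz.2.2 i hi

/-- The transpose of a P-matrix is a P-matrix. -/
lemma aux_transpose {ι : Type*} [Fintype ι] [DecidableEq ι] (A : Matrix ι ι ℝ)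
    (hA : ∀ v : ι → ℝ, v ≠ 0 → ∃ i, 0 < v i * A.mulVec v i) (v : ι → ℝ) (hv : v ≠ 0) :
    ∃ i, 0 < v i * A.vecMul v i := by
  by_contra hcon
  push Not at hcon
  set D : ι → ℝ := fun i => - A.vecMul v i / v i with hD
  have hDn : ∀ i, 0 ≤ D i := by
    intro i
    by_cases h0 : v i = 0
    · simp [hD, h0]
    · have h1 : D i = - (v i * A.vecMul v i) / (v i) ^ 2 := by simp only [hD]; field_simp
      rw [h1]
      have := hcon i
      apply div_nonneg (by linarith) (sq_nonneg _)
  set B : Matrix ι ι ℝ := Matrix.of fun i j =>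
    if v j ≠ 0 then A i j + (if i = j then D j else 0) else (if i = j then 1 else 0) with hB
  have hvB : B.vecMul v = 0 := by
    ext j
    simp only [Matrix.vecMul, dotProduct, hB, Matrix.of_apply, Pi.zero_apply]
    by_cases h0 : v j = 0
    · simp [h0]
    · simp only [ne_eq, h0, not_false_eq_true, if_true, mul_add, Finset.sum_add_distrib]
      simp only [mul_ite, mul_zero, Finset.sum_ite_eq', Finset.mem_univ, if_true]
      have : v j * D j = - A.vecMul v j := by simp only [hD]; field_simp
      rw [this]
      simp [Matrix.vecMul, dotProduct]
  have hdet : B.det = 0 := Matrix.exists_vecMul_eq_zero_iff.1 ⟨v, hv, hvB⟩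
  obtain ⟨w, hw, hBw⟩ := Matrix.exists_mulVec_eq_zero_iff.2 hdet
  set w' : ι → ℝ := fun i => if v i ≠ 0 then w i else 0 with hw'
  have hBi : ∀ i, A.mulVec w' i + (if v i ≠ 0 then D i * w i else w i) = 0 := by
    intro i
    have := congrFun hBw i
    rw [Pi.zero_apply] at this
    refine Eq.trans ?_ this
    simp only [Matrix.mulVec, dotProduct, hB, Matrix.of_apply, hw']
    have h2 : (if v i ≠ 0 then D i * w i else w i) =
        ∑ j, if i = j then (if v j ≠ 0 then D j * w j else w j) else 0 := by simp
    rw [h2, ← Finset.sum_add_distrib]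
    apply Finset.sum_congr rfl
    intro j _
    by_cases hij : i = j
    · subst hij
      by_cases h0 : v i = 0 <;> simp [h0]
      ring
    · by_cases h0 : v j = 0 <;> simp [h0, hij]
  have hw'0 : w' ≠ 0 := by
    intro h0
    apply hw
    ext i
    by_cases hvi : v i = 0
    · have := hBi i
      rw [h0] at this
      simpa [hvi] using this
    · have := congrFun h0 i
      simpa [hw', hvi] using this
  obtain ⟨i, hi⟩ := hA w' hw'0
  have h1 := hBi i
  by_cases hvi : v i = 0
  · simp [hw', hvi] at hi
  · have h3 : w' i = w i := by simp [hw', hvi]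
    rw [h3] at hi
    simp only [ne_eq, hvi, not_false_eq_true, if_true] at h1
    have h4 : A.mulVec w' i = - (D i * w i) := by linarith
    rw [h4] at hi
    nlinarith [mul_nonneg (hDn i) (sq_nonneg (w i))]

/-- A P-matrix maps some positive vector to a positive vector. -/
lemma aux_semipos {ι : Type*} [Fintype ι] [DecidableEq ι] (A : Matrix ι ι ℝ)
    (hA : ∀ v : ι → ℝ, v ≠ 0 → ∃ i, 0 < v i * A.mulVec v i) :
    ∃ u : ι → ℝ, (∀ i, 0 < u i) ∧ ∀ i, 0 < A.mulVec u i := by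
  by_contra hcon
  push Not at hcon
  set s : Set (ι → ℝ) := {y | ∀ i, 0 < y i} with hs
  have hs1 : IsOpen s := by
    have : s = Set.pi Set.univ (fun _ => Set.Ioi 0) := by ext; simp [hs]
    rw [this]
    exact isOpen_set_pi Set.finite_univ (fun _ _ => isOpen_Ioi)
  have hs2 : Convex ℝ s := by
    have : s = Set.pi Set.univ (fun _ => Set.Ioi 0) := by ext; simp [hs]
    rw [this]
    exact convex_pi (fun _ _ => convex_Ioi 0)
  obtain ⟨f, c, h1, h2⟩ := geometric_hahn_banach_open hs2 hs1
    (hs2.linear_image A.mulVecLin) (by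
      rw [Set.disjoint_left]
      rintro y hy ⟨u, hu, rfl⟩
      obtain ⟨i, hi⟩ := hcon u hu
      exact absurd (hy i) (not_lt.2 hi))
  have h2' : ∀ u ∈ s, c ≤ f (A.mulVec u) := fun u hu => h2 _ ⟨u, hu, rfl⟩
  have hone : (1 : ι → ℝ) ∈ s := fun i => by simp
  have hsm : ∀ t : ℝ, 0 < t → ∀ u ∈ s, t • u ∈ s := fun t ht u hu i => by
    simpa using mul_pos ht (hu i)
  -- cone facts
  have hc0 : 0 ≤ c := by
    have : Filter.Tendsto (fun t : ℝ => f (t • (1 : ι → ℝ))) (nhdsWithin 0 (Set.Ioi 0)) (nhds 0) := by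
      have : Continuous (fun t : ℝ => f (t • (1 : ι → ℝ))) := by fun_prop
      have h := this.tendsto 0
      simp only [zero_smul, map_zero] at h
      exact h.mono_left nhdsWithin_le_nhds
    apply le_of_tendsto this
    filter_upwards [self_mem_nhdsWithin] with t ht
    exact (h1 _ (hsm t ht _ hone)).le
  have hc1 : c ≤ 0 := by
    have : Filter.Tendsto (fun t : ℝ => f (A.mulVec (t • (1 : ι → ℝ))))
        (nhdsWithin 0 (Set.Ioi 0)) (nhds 0) := by
      have : Continuous (fun t : ℝ => f (A.mulVec (t • (1 : ι → ℝ)))) := by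
        simp only [Matrix.mulVec_smul]; fun_prop
      have h := this.tendsto 0
      simp only [zero_smul, map_zero, Matrix.mulVec_zero] at h
      exact h.mono_left nhdsWithin_le_nhds
    apply ge_of_tendsto this
    filter_upwards [self_mem_nhdsWithin] with t ht
    exact (h2' _ (hsm t ht _ hone))
  have hc : c = 0 := le_antisymm hc1 hc0
  subst hc
  set w : ι → ℝ := fun i => f (Pi.single i 1) with hw
  have hf : ∀ y, f y = ∑ i, y i * w i := by
    intro y
    conv_lhs => rw [pi_eq_sum_univ' y]
    rw [map_sum]
    apply Finset.sum_congr rfl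
    intro i _
    rw [map_smul, smul_eq_mul, hw]
  -- closure facts
  have hcl : ∀ i, Filter.Tendsto (fun t : ℝ => (Pi.single i 1 + t • (1 : ι → ℝ) : ι → ℝ))
      (nhdsWithin 0 (Set.Ioi 0)) (nhds (Pi.single i 1)) := by
    intro i
    have : Continuous (fun t : ℝ => (Pi.single i 1 + t • (1 : ι → ℝ) : ι → ℝ)) := by fun_prop
    have h := this.tendsto 0
    simp only [zero_smul, add_zero] at h
    exact h.mono_left nhdsWithin_le_nhds
  have hmem : ∀ i, ∀ t : ℝ, 0 < t → (Pi.single i 1 + t • (1 : ι → ℝ) : ι → ℝ) ∈ s := by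
    intro i t ht j
    by_cases hij : j = i
    · subst hij; simp; linarith
    · simp [hij, ht]
  have hw1 : ∀ i, w i ≤ 0 := by
    intro i
    apply le_of_tendsto ((f.continuous.tendsto _).comp (hcl i))
    filter_upwards [self_mem_nhdsWithin] with t ht
    exact (h1 _ (hmem i t ht)).le
  have hw2 : ∀ j, 0 ≤ A.vecMul w j := by
    intro j
    have hAc : Continuous (fun u : ι → ℝ => f (A.mulVec u)) := by
      have : Continuous (fun u : ι → ℝ => A.mulVecLin u) := LinearMap.continuous_of_finiteDimensional _
      exact f.continuous.comp this
    have h3 : A.vecMul w j = f (A.mulVec (Pi.single j 1)) := by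
      rw [hf]
      simp [Matrix.vecMul, dotProduct, mul_comm]
    rw [h3]
    apply ge_of_tendsto ((hAc.tendsto _).comp (hcl j))
    filter_upwards [self_mem_nhdsWithin] with t ht
    exact h2' _ (hmem j t ht)
  have hw0 : w ≠ 0 := by
    intro h0
    have := h1 _ hone
    rw [hf, h0] at this
    simp at this
  obtain ⟨i, hi⟩ := aux_transpose A hA w hw0
  have := mul_nonpos_of_nonpos_of_nonneg (hw1 i) (hw2 i)
  linarith

/-- Signed, supported version. -/
lemma aux_signed {ι : Type*} [Fintype ι] [DecidableEq ι] (A : Matrix ι ι ℝ)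
    (hA : ∀ v : ι → ℝ, v ≠ 0 → ∃ i, 0 < v i * A.mulVec v i) (d : ι → ℝ) :
    ∃ u : ι → ℝ, (∀ i, d i = 0 → u i = 0) ∧
      ∀ i, d i ≠ 0 → 0 < d i * u i ∧ 0 < d i * A.mulVec u i := by
  set B : Matrix ι ι ℝ := Matrix.of fun i j =>
    d i * A i j * d j + (if i = j then (if d i = 0 then 1 else 0) else 0) with hB
  have hBv : ∀ v i, B.mulVec v i =
      d i * A.mulVec (fun j => d j * v j) i + (if d i = 0 then v i else 0) := by
    intro v i
    simp only [hB, Matrix.mulVec, dotProduct, Matrix.of_apply, add_mul, Finset.sum_add_distrib,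
      Finset.mul_sum]
    congr 1
    · exact Finset.sum_congr rfl fun j _ => by ring
    · simp
  obtain ⟨u, hu, hBu⟩ := aux_semipos B (by
    intro v hv
    by_cases hex : ∃ i, d i = 0 ∧ v i ≠ 0
    · obtain ⟨i, hi, hvi⟩ := hex
      refine ⟨i, ?_⟩
      rw [hBv]
      simp only [hi, zero_mul, if_true, zero_add]
      exact mul_self_pos.2 hvi
    · push Not at hex
      obtain ⟨i, hi⟩ := hA (fun j => d j * v j) (by
        intro h0
        apply hv
        ext i
        by_cases hdi : d i = 0
        · exact hex i hdi
        · have := congrFun h0 i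
          simpa [hdi] using this)
      refine ⟨i, ?_⟩
      rw [hBv]
      have hdi : d i ≠ 0 := by rintro h0; simp [h0] at hi
      simp only [hdi, if_false, add_zero]
      linarith)
  refine ⟨fun j => d j * u j, fun i hi => by simp [hi], fun i hi => ⟨?_, ?_⟩⟩
  · have := mul_pos (mul_self_pos.2 hi) (hu i)
    simp only; linarith
  · have := hBu i
    rw [hBv] at this
    simpa [hi] using this

open Filter Topology in
/-- Local P-property at a point with P-matrix derivative. -/
lemma aux_local {ι : Type*} [Fintype ι] [DecidableEq ι] (G : (ι → ℝ) → ι → ℝ) (A : Matrix ι ι ℝ)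
    (hA : ∀ v : ι → ℝ, v ≠ 0 → ∃ i, 0 < v i * A.mulVec v i) (y : ι → ℝ)
    (hG : HasFDerivAt G (LinearMap.toContinuousLinearMap A.mulVecLin) y) :
    ∃ δ > 0, ∀ z, z ≠ y → ‖z - y‖ < δ → ∃ i, 0 < (z i - y i) * (G z i - G y i) := by
  set φ : (ι → ℝ) → ℝ := fun w => ∑ i, max (w i * A.mulVec w i) 0 with hφ
  have hmc : Continuous (fun w : ι → ℝ => A.mulVec w) := by
    have : Continuous (fun u : ι → ℝ => A.mulVecLin u) := LinearMap.continuous_of_finiteDimensional _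
    exact this
  have hφc : Continuous φ := by
    apply continuous_finsetSum
    intro i _
    exact ((continuous_apply i).mul ((continuous_apply i).comp hmc)).max continuous_const
  have hφp : ∀ w, w ≠ 0 → 0 < φ w := by
    intro w hw
    obtain ⟨i, hi⟩ := hA w hw
    apply Finset.sum_pos' (fun j _ => le_max_right _ _)
    exact ⟨i, Finset.mem_univ i, lt_max_of_lt_left hi⟩
  obtain ⟨c, hc, hcb⟩ : ∃ c > 0, ∀ w : ι → ℝ, ‖w‖ = 1 → c ≤ φ w := by
    rcases (Metric.sphere (0 : ι → ℝ) 1).eq_empty_or_nonempty with he | hne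
    · refine ⟨1, one_pos, fun w hw => ?_⟩
      have : w ∈ Metric.sphere (0 : ι → ℝ) 1 := by simpa using hw
      rw [he] at this
      exact absurd this (Set.notMem_empty _)
    · obtain ⟨w0, hw0, hmin⟩ := (isCompact_sphere (0 : ι → ℝ) 1).exists_isMinOn hne hφc.continuousOn
      refine ⟨φ w0, hφp w0 ?_, fun w hw => hmin (by simpa using hw)⟩
      rintro rfl
      simp at hw0
  have hcb' : ∀ w : ι → ℝ, c * ‖w‖ ^ 2 ≤ φ w := by
    intro w
    by_cases hw : w = 0
    · subst hw; simp [hφ]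
    have hn : 0 < ‖w‖ := norm_pos_iff.2 hw
    have h1 := hcb (‖w‖⁻¹ • w) (by rw [norm_smul]; simp [hn.ne'])
    have h2 : φ w = ‖w‖ ^ 2 * φ (‖w‖⁻¹ • w) := by
      simp only [hφ, Finset.mul_sum]
      apply Finset.sum_congr rfl
      intro i _
      rw [mul_max_of_nonneg _ _ (sq_nonneg _), Matrix.mulVec_smul]
      simp only [Pi.smul_apply, smul_eq_mul, mul_zero]
      congr 1
      field_simp
    rw [h2]
    nlinarith [sq_nonneg ‖w‖]
  set ε : ℝ := c / (Fintype.card ι + 1) with hε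
  have hε0 : 0 < ε := by positivity
  have hlo := (hasFDerivAt_iff_isLittleO.1 hG).def hε0
  obtain ⟨δ, hδ, hball⟩ := Metric.eventually_nhds_iff.1 hlo
  refine ⟨δ, hδ, fun z hz hzd => ?_⟩
  by_contra hcon
  push Not at hcon
  have hb := hball (y := z) (by rw [dist_eq_norm]; exact hzd)
  set w := z - y with hw
  have hwn : 0 < ‖w‖ := norm_pos_iff.2 (sub_ne_zero.2 hz)
  have hterm : ∀ i, max (w i * A.mulVec w i) 0 ≤ ε * ‖w‖ ^ 2 := by
    intro i
    apply max_le _ (by positivity)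
    have h1 : |G z i - G y i - A.mulVec w i| ≤ ε * ‖w‖ := by
      have := (norm_le_pi_norm (G z - G y - (LinearMap.toContinuousLinearMap A.mulVecLin) w) i).trans hb
      simpa using this
    have h2 : |w i| ≤ ‖w‖ := norm_le_pi_norm w i
    have h3 := hcon i
    have h4 : w i * A.mulVec w i = w i * (G z i - G y i) - w i * (G z i - G y i - A.mulVec w i) := by
      ring
    have h5 : |w i * (G z i - G y i - A.mulVec w i)| ≤ ‖w‖ * (ε * ‖w‖) := by
      rw [abs_mul]
      exact mul_le_mul h2 h1 (abs_nonneg _) (norm_nonneg _)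
    have h6 := neg_abs_le (w i * (G z i - G y i - A.mulVec w i))
    have h7 : w i = z i - y i := rfl
    rw [← h7] at h3
    nlinarith
  have hsum : φ w ≤ Fintype.card ι * (ε * ‖w‖ ^ 2) := by
    have := Finset.sum_le_card_nsmul Finset.univ _ _ (fun i _ => hterm i)
    simpa [hφ] using this
  have h1 := hcb' w
  have h2 : c = (Fintype.card ι + 1) * ε := by rw [hε]; field_simp
  rw [h2] at h1
  have : 0 < ε * ‖w‖ ^ 2 := by positivity
  nlinarith

open Filter Topology in
/-- Gale–Nikaido / Moré–Rheinboldt: P-matrix derivatives on a rectangle give a P-function. -/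
lemma aux_pfun {ι : Type*} [Fintype ι] [DecidableEq ι] (G : (ι → ℝ) → ι → ℝ)
    (A : (ι → ℝ) → Matrix ι ι ℝ) (K : Set (ι → ℝ))
    (hK : ∀ x ∈ K, ∀ y ∈ K, Set.uIcc x y ⊆ K)
    (hG : ∀ y, HasFDerivAt G (LinearMap.toContinuousLinearMap (A y).mulVecLin) y)
    (hA : ∀ q ∈ K, ∀ v : ι → ℝ, v ≠ 0 → ∃ i, 0 < v i * (A q).mulVec v i) (n : ℕ) :
    ∀ x ∈ K, ∀ y ∈ K, (Finset.univ.filter fun i => x i ≠ y i).card ≤ n → x ≠ y →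
      ∃ i, 0 < (x i - y i) * (G x i - G y i) := by
  have hGc : Continuous G := continuous_iff_continuousAt.2 fun y => (hG y).continuousAt
  have hGi : ∀ i, Continuous fun z => G z i := fun i => (continuous_apply i).comp hGc
  induction n with
  | zero =>
    intro x _ y _ hc hne
    exfalso
    apply hne
    ext i
    by_contra hi
    have : i ∈ (Finset.univ.filter fun i => x i ≠ y i) := by simp [hi]
    rw [Nat.le_zero, Finset.card_eq_zero] at hc
    rw [hc] at this
    simp at this
  | succ n ih =>
    intro x hx y hy hcard hne
    by_contra hcon
    push Not at hcon
    set d : ι → ℝ := x - y with hd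
    have hdi : ∀ i, d i = x i - y i := fun i => rfl
    obtain ⟨δ, hδ, hloc⟩ := aux_local G (A y) (hA y hy) y (hG y)
    -- candidate predicate
    set X : Set (ι → ℝ) := {z | z ∈ Set.uIcc x y ∧ δ ≤ ‖z - y‖ ∧
      ∀ i, d i * (G z i - G y i) ≤ 0} with hX
    have huc : ∀ z ∈ Set.uIcc x y, ∀ i, ∃ t, 0 ≤ t ∧ t ≤ 1 ∧ z i - y i = t * d i := by
      intro z hz i
      have hzi : z i ∈ Set.uIcc (y i) (x i) := by
        rw [Set.uIcc_comm]
        exact ⟨hz.1 i, hz.2 i⟩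
      rw [← segment_eq_uIcc, segment_eq_image'] at hzi
      obtain ⟨t, ht, h⟩ := hzi
      refine ⟨t, ht.1, ht.2, ?_⟩
      simp only [smul_eq_mul] at h
      rw [hdi, ← h]; ring
    have hmk : ∀ z ∈ Set.uIcc x y, z ≠ y → (∀ i, d i * (G z i - G y i) ≤ 0) → z ∈ X := by
      intro z hz hzy h
      refine ⟨hz, ?_, h⟩
      by_contra hlt
      push Not at hlt
      obtain ⟨i, hi⟩ := hloc z hzy hlt
      obtain ⟨t, ht, _, h2⟩ := huc z hz i
      rw [h2] at hi
      nlinarith [h i]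
    have hXne : X.Nonempty := ⟨x, hmk x Set.left_mem_uIcc hne hcon⟩
    have hXc : IsCompact X := by
      have hcl : IsClosed {z : ι → ℝ | δ ≤ ‖z - y‖ ∧ ∀ i, d i * (G z i - G y i) ≤ 0} := by
        simp only [Set.ofPred_and, Set.ofPred_forall]
        apply IsClosed.inter
        · exact isClosed_le continuous_const (by fun_prop)
        · exact isClosed_iInter fun i =>
            isClosed_le (continuous_const.mul ((hGi i).sub continuous_const)) continuous_const
      exact (isCompact_Icc (a := x ⊓ y) (b := x ⊔ y)).inter_right hcl
    obtain ⟨z, hzX, hmin⟩ := hXc.exists_isMinOn hXne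
      (f := fun z : ι → ℝ => ∑ i, d i * (z i - y i)) (by fun_prop)
    have hzK : z ∈ K := hK x hx y hy hzX.1
    have hzy : z ≠ y := by
      rintro rfl
      have := hzX.2.1
      simp at this
      linarith
    -- all coordinates in the support have moved
    have hzi : ∀ i, d i ≠ 0 → z i ≠ y i := by
      intro i hi heq
      obtain ⟨j, hj⟩ := ih z hzK y hy (by
        have hlt : (Finset.univ.filter fun i => z i ≠ y i).card <
            (Finset.univ.filter fun i => x i ≠ y i).card := by
          apply Finset.card_lt_card
          rw [Finset.ssubset_iff_of_subset]
          · refine ⟨i, ?_, by simp [heq]⟩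
            rw [hdi] at hi
            simpa [sub_eq_zero] using hi
          · intro j hj
            simp only [Finset.mem_filter, Finset.mem_univ, true_and] at hj ⊢
            intro hxy
            obtain ⟨t, _, _, h2⟩ := huc z hzX.1 j
            rw [hdi, hxy] at h2
            apply hj
            simp at h2
            linarith
        omega) hzy
      obtain ⟨t, ht, _, h2⟩ := huc z hzX.1 j
      rw [h2] at hj
      nlinarith [hzX.2.2 j]
    obtain ⟨u, hu0, hu⟩ := aux_signed (A z) (hA z hzK) d
    obtain ⟨i0, hi0⟩ : ∃ i, d i ≠ 0 := by
      by_contra h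
      push Not at h
      apply hne
      ext i
      have := h i
      rw [hdi] at this
      linarith
    -- moving in the direction -u
    have hline : ∀ i, HasDerivAt (fun e : ℝ => d i * G (z - e • u) i) (- (d i * (A z).mulVec u i)) 0 := by
      intro i
      have h1 : HasDerivAt (fun e : ℝ => z - e • u) (-u) 0 := by
        have := ((hasDerivAt_id (0 : ℝ)).smul_const u).const_sub z
        simpa using this
      have h2 : HasFDerivAt G (LinearMap.toContinuousLinearMap (A z).mulVecLin) (z - (0 : ℝ) • u) := by
        simpa using hG z
      have h3 := h2.comp_hasDerivAt (0 : ℝ) h1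
      have h4 := (hasDerivAt_pi.1 h3 i).const_mul (d i)
      simpa [Matrix.mulVec_neg] using h4
    have hev : ∀ i, ∀ᶠ e in 𝓝[>] (0 : ℝ), d i * (G (z - e • u) i - G y i) ≤ 0 := by
      intro i
      by_cases hi : d i = 0
      · simp [hi]
      have h1 := (hline i).tendsto_slope_zero_right
      have h2 : - (d i * (A z).mulVec u i) < 0 := by linarith [(hu i hi).2]
      filter_upwards [h1.eventually_lt_const h2, self_mem_nhdsWithin] with e he hpos
      have hpos' : (0 : ℝ) < e := hpos
      simp only [zero_add, smul_eq_mul, zero_smul, sub_zero] at he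
      have h3 : d i * G (z - e • u) i - d i * G z i < 0 := by
        by_contra hge
        push Not at hge
        have := mul_nonneg (inv_pos.2 hpos').le hge
        linarith
      have := hzX.2.2 i
      nlinarith
    have hev2 : ∀ i, ∀ᶠ e in 𝓝[>] (0 : ℝ), (z - e • u) i ∈ Set.uIcc (x i) (y i) ∧
        (d i ≠ 0 → (z - e • u) i ≠ y i) := by
      intro i
      by_cases hi : d i = 0
      · refine Eventually.of_forall fun e => ⟨?_, fun h => absurd hi h⟩
        have : (z - e • u) i = z i := by simp [hu0 i hi]
        rw [this]
        exact ⟨hzX.1.1 i, hzX.1.2 i⟩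
      obtain ⟨t, ht0, ht1, h2⟩ := huc z hzX.1 i
      have htpos : 0 < t := by
        rcases ht0.lt_or_eq with h | h
        · exact h
        · exfalso
          rw [← h] at h2
          exact hzi i hi (by linarith)
      have hcont : Tendsto (fun e : ℝ => t - e * (u i / d i)) (𝓝[>] 0) (𝓝 t) := by
        have : Continuous (fun e : ℝ => t - e * (u i / d i)) := by fun_prop
        have h := this.tendsto 0
        simp only [zero_mul, sub_zero] at h
        exact h.mono_left nhdsWithin_le_nhds
      filter_upwards [hcont.eventually_const_lt htpos, self_mem_nhdsWithin] with e he hpos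
      have hpos' : (0 : ℝ) < e := hpos
      have hud : 0 < u i / d i := by
        have h5 : u i / d i = (d i * u i) / (d i) ^ 2 := by field_simp
        rw [h5]
        exact div_pos (hu i hi).1 (by positivity)
      have heq : (z - e • u) i = y i + (t - e * (u i / d i)) * d i := by
        have : z i = y i + t * d i := by linarith
        simp only [Pi.sub_apply, Pi.smul_apply, smul_eq_mul, this]
        field_simp
        ring
      constructor
      · rw [heq, Set.uIcc_comm, ← segment_eq_uIcc, segment_eq_image']
        refine ⟨t - e * (u i / d i), ⟨he.le, ?_⟩, by simp [hdi]⟩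
        have := mul_pos hpos' hud
        linarith
      · intro _ h
        rw [heq] at h
        have : (t - e * (u i / d i)) * d i = 0 := by linarith
        rcases mul_eq_zero.1 this with h | h
        · linarith
        · exact hi h
    obtain ⟨e, ⟨he1, he2⟩, hpos⟩ := (((eventually_all.2 hev).and (eventually_all.2 hev2)).and
      self_mem_nhdsWithin).exists
    have hpos' : (0 : ℝ) < e := hpos
    have hmem : z - e • u ∈ X := by
      apply hmk
      · exact ⟨fun i => (he2 i).1.1, fun i => (he2 i).1.2⟩
      · intro h
        exact (he2 i0).2 hi0 (congrFun h i0)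
      · exact he1
    have hle := hmin hmem
    simp only [Set.mem_ofPred_eq] at hle
    have hlt : ∑ i, d i * ((z - e • u) i - y i) < ∑ i, d i * (z i - y i) := by
      apply Finset.sum_lt_sum
      · intro i _
        by_cases hi : d i = 0
        · simp [hi]
        · have := mul_pos hpos' (hu i hi).1
          simp only [Pi.sub_apply, Pi.smul_apply, smul_eq_mul]
          nlinarith
      · refine ⟨i0, Finset.mem_univ _, ?_⟩
        have := mul_pos hpos' (hu i0 hi0).1
        simp only [Pi.sub_apply, Pi.smul_apply, smul_eq_mul]
        nlinarith
    exact absurd hle (not_le.2 hlt)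

/-- The key linear-algebra estimate. -/
lemma aux_block {m c : Type*} [Fintype m] [DecidableEq m] [Fintype c] [DecidableEq c]
    (J : Matrix (m × c) (m × c) ℝ)
    (hoff : ∀ ℓ i j, i ≠ j → 0 ≤ J (i, ℓ) (j, ℓ)) (hcol : ∀ ℓ j, ∑ i, J (i, ℓ) (j, ℓ) ≤ 0)
    (hdom : ∀ ℓ, ∑ p ∈ Finset.univ.erase ℓ, sigmaMax (Matrix.of fun i j => J (i, p) (j, ℓ))
      < sigmaMin (Matrix.of fun i j => J (i, ℓ) (j, ℓ)))
    (v : m × c → ℂ) (hv : v ≠ 0) :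
    ∃ a, ((starRingEnd ℂ) (v a) * ∑ b, (J a b : ℂ) * v b).re < 0 := by
  by_contra hcon
  push Not at hcon
  set V : c → EuclideanSpace ℂ m := fun ℓ => WithLp.toLp 2 (fun i => v (i, ℓ)) with hV
  set Y : c → c → EuclideanSpace ℂ m := fun p ℓ =>
    WithLp.toLp 2 (fun i => ∑ j, (J (i, p) (j, ℓ) : ℂ) * v (j, ℓ)) with hY
  have hYn : ∀ p ℓ, ‖Y p ℓ‖ ≤ sigmaMax (Matrix.of fun i j => J (i, p) (j, ℓ)) * ‖V ℓ‖ := by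
    intro p ℓ
    exact sigmaMax_norm_le (Matrix.of fun i j => J (i, p) (j, ℓ)) (fun i => v (i, ℓ))
  have hpos : ∀ ℓ, 0 < sigmaMin (Matrix.of fun i j => J (i, ℓ) (j, ℓ)) := fun ℓ =>
    lt_of_le_of_lt (Finset.sum_nonneg fun p _ => Real.sqrt_nonneg _) (hdom ℓ)
  have hkey : ∀ p, sigmaMin (Matrix.of fun i j => J (i, p) (j, p)) * ‖V p‖ ≤
      ∑ ℓ ∈ Finset.univ.erase p, ‖Y p ℓ‖ := by
    intro p
    refine le_trans ?_ (norm_sum_le _ _)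
    refine aux_compare (Matrix.of fun i j => J (i, p) (j, p)) (hoff p) (hcol p) (hpos p) _ _ ?_
    intro i
    set r : ℂ := (∑ ℓ ∈ Finset.univ.erase p, Y p ℓ).ofLp i with hr
    have hsplit : ∑ b, (J (i, p) b : ℂ) * v b = ∑ j, (J (i, p) (j, p) : ℂ) * v (j, p) + r := by
      rw [Fintype.sum_prod_type_right, ← Finset.add_sum_erase _ _ (Finset.mem_univ p), hr]
      simp [hY]
    have hc := hcon (i, p)
    rw [hsplit] at hc
    have hVj : ∀ j, (V p).ofLp j = v (j, p) := fun j => rfl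
    simp only [hVj, Matrix.of_apply]
    by_cases h0 : v (i, p) = 0
    · have : 0 ≤ ∑ j, J (i, p) (j, p) * ‖v (j, p)‖ := by
        apply Finset.sum_nonneg
        intro j _
        by_cases hij : i = j
        · subst hij; simp [h0]
        · exact mul_nonneg (hoff p i j hij) (norm_nonneg _)
      linarith [norm_nonneg r]
    · have hn : 0 < ‖v (i, p)‖ := norm_pos_iff.2 h0
      have h1 : ((starRingEnd ℂ) (v (i, p)) * ∑ j, (J (i, p) (j, p) : ℂ) * v (j, p)).re
          ≤ ‖v (i, p)‖ * ∑ j, J (i, p) (j, p) * ‖v (j, p)‖ := by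
        rw [Finset.mul_sum, Finset.mul_sum, Complex.re_sum]
        apply Finset.sum_le_sum
        intro j _
        have h2 : (starRingEnd ℂ) (v (i, p)) * ((J (i, p) (j, p) : ℂ) * v (j, p)) =
          (J (i, p) (j, p) : ℂ) * ((starRingEnd ℂ) (v (i, p)) * v (j, p)) := by ring
        rw [h2, Complex.re_ofReal_mul]
        by_cases hij : i = j
        · subst hij
          rw [← Complex.normSq_eq_conj_mul_self, Complex.ofReal_re, Complex.normSq_eq_norm_sq]
          apply le_of_eq; ring
        · have h3 : ((starRingEnd ℂ) (v (i, p)) * v (j, p)).re ≤ ‖v (i, p)‖ * ‖v (j, p)‖ := by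
            refine (Complex.re_le_norm _).trans ?_
            rw [norm_mul, Complex.norm_conj]
          have := mul_le_mul_of_nonneg_left h3 (hoff p i j hij)
          linarith
      have h2 : ((starRingEnd ℂ) (v (i, p)) * r).re ≤ ‖v (i, p)‖ * ‖r‖ := by
        refine (Complex.re_le_norm _).trans ?_
        rw [norm_mul, Complex.norm_conj]
      rw [mul_add, Complex.add_re] at hc
      have h3 : 0 ≤ ‖v (i, p)‖ * (∑ j, J (i, p) (j, p) * ‖v (j, p)‖ + ‖r‖) := by linarith
      have h4 := nonneg_of_mul_nonneg_right h3 hn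
      linarith
  have hsum : ∑ p, sigmaMin (Matrix.of fun i j => J (i, p) (j, p)) * ‖V p‖ ≤
      ∑ ℓ, (∑ p ∈ Finset.univ.erase ℓ, sigmaMax (Matrix.of fun i j => J (i, p) (j, ℓ))) * ‖V ℓ‖ := by
    calc _ ≤ ∑ p, ∑ ℓ ∈ Finset.univ.erase p,
          sigmaMax (Matrix.of fun i j => J (i, p) (j, ℓ)) * ‖V ℓ‖ :=
        Finset.sum_le_sum fun p _ => (hkey p).trans (Finset.sum_le_sum fun ℓ _ => hYn p ℓ)
      _ = _ := by
        simp only [Finset.sum_mul]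
        apply Finset.sum_comm'
        intro x y
        simp [eq_comm]
  have hlt : ∑ ℓ, (∑ p ∈ Finset.univ.erase ℓ, sigmaMax (Matrix.of fun i j => J (i, p) (j, ℓ)))
      * ‖V ℓ‖ < ∑ p, sigmaMin (Matrix.of fun i j => J (i, p) (j, p)) * ‖V p‖ := by
    apply Finset.sum_lt_sum
    · exact fun ℓ _ => mul_le_mul_of_nonneg_right (hdom ℓ).le (norm_nonneg _)
    · obtain ⟨⟨i, ℓ⟩, hil⟩ := Function.ne_iff.1 hv
      refine ⟨ℓ, Finset.mem_univ _, mul_lt_mul_of_pos_right (hdom ℓ) (norm_pos_iff.2 ?_)⟩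
      intro h0
      apply hil
      have : (V ℓ).ofLp i = 0 := by rw [h0]; rfl
      exact this
  linarith

namespace MultiCommoditySystem

variable {N C : ℕ} (S : MultiCommoditySystem N C)

lemma aux_diff_g (i j : Fin N) (h : (i, j) ∈ S.E) (ℓ : Fin C) :
    Differentiable ℝ (fun q : Fin N × Fin C → ℝ =>
      S.g i j ℓ (fun c => q (i, c)) (fun c => q (j, c))) := by
  have h1 := (S.g_contDiff (i, j) h ℓ).differentiable (by norm_num)
  have h2 : Differentiable ℝ (fun q : Fin N × Fin C → ℝ =>
    ((fun c => q (i, c), fun c => q (j, c)) : (Fin C → ℝ) × (Fin C → ℝ))) := by fun_prop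
  exact h1.comp h2

lemma aux_diff_gT (i : Fin N) (ℓ : Fin C) :
    Differentiable ℝ (fun q : Fin N × Fin C → ℝ => S.gT i ℓ (fun c => q (i, c))) := by
  have h1 := (S.gT_contDiff i ℓ).differentiable (by norm_num)
  have h2 : Differentiable ℝ (fun q : Fin N × Fin C → ℝ => (fun c => q (i, c))) := by fun_prop
  exact h1.comp h2

lemma aux_diff_f (i : Fin N) (ℓ : Fin C) :
    Differentiable ℝ (fun q : Fin N × Fin C → ℝ => S.f q i ℓ) := by
  unfold f
  refine ((Differentiable.add (differentiable_const _) ?_).sub ?_).sub (S.aux_diff_gT i ℓ)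
  · exact Differentiable.fun_sum fun k hk => S.aux_diff_g k i (Finset.mem_filter.1 hk).2 ℓ
  · exact Differentiable.fun_sum fun k hk => S.aux_diff_g i k (Finset.mem_filter.1 hk).2 ℓ

lemma aux_diff_update {φ : (Fin N × Fin C → ℝ) → ℝ} (hφ : Differentiable ℝ φ)
    (q : Fin N × Fin C → ℝ) (v : Fin N × Fin C) :
    Differentiable ℝ (fun x => φ (Function.update q v x)) := by
  have : Differentiable ℝ (fun x : ℝ => Function.update q v x) :=
    fun x => (hasDerivAt_update q v x).differentiableAt
  exact hφ.comp this

lemma aux_hasFDeriv (q : Fin N × Fin C → ℝ) :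
    HasFDerivAt (fun q (v : Fin N × Fin C) => S.f q v.1 v.2)
      (LinearMap.toContinuousLinearMap (S.jacobian q).mulVecLin) q := by
  rw [hasFDerivAt_pi']
  intro a
  have h1 := (S.aux_diff_f a.1 a.2 q).hasFDerivAt
  refine h1.congr_fderiv ?_
  refine ContinuousLinearMap.ext fun w => ?_
  have hJ : ∀ v, S.jacobian q a v = fderiv ℝ (fun q => S.f q a.1 a.2) q (Pi.single v 1) := by
    intro v
    unfold jacobian
    have h2 : HasFDerivAt (fun q => S.f q a.1 a.2) (fderiv ℝ (fun q => S.f q a.1 a.2) q)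
      (Function.update q v (q v)) := by simpa using h1
    exact (h2.comp_hasDerivAt (q v) (hasDerivAt_update q v (q v))).deriv
  have hw : w = ∑ v, w v • (Pi.single v 1 : Fin N × Fin C → ℝ) := by
    ext b
    simp [Finset.sum_apply, Pi.single_apply]
  conv_lhs => rw [hw, map_sum]
  simp only [map_smul, ← hJ, smul_eq_mul]
  simp [Matrix.mulVec, dotProduct, mul_comm]

lemma aux_upd_ne (q : Fin N × Fin C → ℝ) (j k : Fin N) (ℓ : Fin C) (x : ℝ) (h : k ≠ j) :
    (fun c => Function.update q (j, ℓ) x (k, c)) = fun c => q (k, c) := by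
  ext c
  rw [Function.update_of_ne]
  simp [h]

lemma aux_upd_eq (q : Fin N × Fin C → ℝ) (j : Fin N) (ℓ : Fin C) (x : ℝ) :
    (fun c => Function.update q (j, ℓ) x (j, c)) = Function.update (fun c => q (j, c)) ℓ x := by
  ext c
  by_cases hc : c = ℓ
  · subst hc; simp
  · rw [Function.update_of_ne (by simp [hc]), Function.update_of_ne hc]

lemma aux_off (q : Fin N × Fin C → ℝ) (hM : S.MMatrixCond q) (ℓ : Fin C) (i j : Fin N)
    (hij : i ≠ j) : 0 ≤ S.jacobian q (i, ℓ) (j, ℓ) := by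
  unfold jacobian f
  simp only [aux_upd_ne q j i ℓ _ hij]
  have hd1 : ∀ k ∈ Finset.univ.filter (fun k => (k, i) ∈ S.E), DifferentiableAt ℝ
      (fun x => S.g k i ℓ (fun c => Function.update q (j, ℓ) x (k, c)) (fun c => q (i, c)))
      (q (j, ℓ)) := by
    intro k hk
    have := aux_diff_update (S.aux_diff_g k i (Finset.mem_filter.1 hk).2 ℓ) q (j, ℓ) (q (j, ℓ))
    simpa only [aux_upd_ne q j i ℓ _ hij] using this
  have hd2 : ∀ k ∈ Finset.univ.filter (fun k => (i, k) ∈ S.E), DifferentiableAt ℝ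
      (fun x => S.g i k ℓ (fun c => q (i, c)) (fun c => Function.update q (j, ℓ) x (k, c)))
      (q (j, ℓ)) := by
    intro k hk
    have := aux_diff_update (S.aux_diff_g i k (Finset.mem_filter.1 hk).2 ℓ) q (j, ℓ) (q (j, ℓ))
    simpa only [aux_upd_ne q j i ℓ _ hij] using this
  rw [deriv_sub_const_fun, deriv_fun_sub ((DifferentiableAt.fun_sum hd1).const_add _)
    (DifferentiableAt.fun_sum hd2), deriv_const_add, deriv_fun_sum hd1, deriv_fun_sum hd2]
  have h1 : 0 ≤ ∑ k ∈ Finset.univ.filter (fun k => (k, i) ∈ S.E), deriv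
      (fun x => S.g k i ℓ (fun c => Function.update q (j, ℓ) x (k, c)) (fun c => q (i, c)))
      (q (j, ℓ)) := by
    apply Finset.sum_nonneg
    intro k hk
    by_cases hkj : k = j
    · subst hkj
      simp only [aux_upd_eq]
      exact ((hM ℓ).1 (k, i) (Finset.mem_filter.1 hk).2).1.le
    · simp only [aux_upd_ne q j k ℓ _ hkj, deriv_const]
      exact le_rfl
  have h2 : ∑ k ∈ Finset.univ.filter (fun k => (i, k) ∈ S.E), deriv
      (fun x => S.g i k ℓ (fun c => q (i, c)) (fun c => Function.update q (j, ℓ) x (k, c)))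
      (q (j, ℓ)) ≤ 0 := by
    apply Finset.sum_nonpos
    intro k hk
    by_cases hkj : k = j
    · subst hkj
      simp only [aux_upd_eq]
      exact ((hM ℓ).1 (i, k) (Finset.mem_filter.1 hk).2).2.le
    · simp only [aux_upd_ne q j k ℓ _ hkj, deriv_const]
      exact le_rfl
  linarith

lemma aux_sum_f (q : Fin N × Fin C → ℝ) (ℓ : Fin C) :
    ∑ i, S.f q i ℓ = ∑ i, S.lam i ℓ - ∑ i, S.gT i ℓ (fun c => q (i, c)) := by
  unfold f
  simp only [Finset.sum_sub_distrib, Finset.sum_add_distrib, Finset.sum_filter]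
  rw [Finset.sum_comm]
  ring

lemma aux_col (q : Fin N × Fin C → ℝ) (hM : S.MMatrixCond q) (ℓ : Fin C) (j : Fin N) :
    ∑ i, S.jacobian q (i, ℓ) (j, ℓ) ≤ 0 := by
  unfold jacobian
  rw [← deriv_fun_sum (fun i _ => aux_diff_update (S.aux_diff_f i ℓ) q (j, ℓ) (q (j, ℓ)))]
  simp only [aux_sum_f]
  rw [deriv_const_sub, deriv_fun_sum
    (fun i _ => aux_diff_update (S.aux_diff_gT i ℓ) q (j, ℓ) (q (j, ℓ)))]
  rw [neg_nonpos]
  apply Finset.sum_nonneg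
  intro k _
  by_cases hkj : k = j
  · subst hkj
    simp only [aux_upd_eq]
    exact (hM ℓ).2.1 k
  · simp only [aux_upd_ne q j k ℓ _ hkj, deriv_const]
    exact le_rfl

lemma aux_key (q : Fin N × Fin C → ℝ) (hB : S.BlockDiagDominant q) (hM : S.MMatrixCond q)
    (v : Fin N × Fin C → ℂ) (hv : v ≠ 0) :
    ∃ a, ((starRingEnd ℂ) (v a) * ∑ b, (S.jacobian q a b : ℂ) * v b).re < 0 :=
  aux_block (S.jacobian q) (S.aux_off q hM) (S.aux_col q hM) hB v hv

end MultiCommoditySystem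

/-- **Theorem 5.**  Suppose that at every feasible point the Jacobian of the
multi-commodity dynamics satisfies block strict diagonal dominance and the
M-matrix condition, and that there are finite reals `bl (i,ℓ) ≤ bu (i,ℓ)`
with `[bl (i,ℓ), bu (i,ℓ)] ⊆ [0, b i ℓ]` such that on the box
`B̄ = Π_{(i,ℓ)} [bl (i,ℓ), bu (i,ℓ)]` one has `f i ℓ (q) ≤ 0` whenever
`q (i,ℓ) = bu (i,ℓ)` and `f i ℓ (q) ≥ 0` whenever `q (i,ℓ) = bl (i,ℓ)`.
Then the system has exactly one equilibrium point; it lies in `B̄`, and every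
eigenvalue of the Jacobian there has strictly negative real part. -/
theorem stmt7 {N C : ℕ} (S : MultiCommoditySystem N C)
    (h : ∀ q, S.Feasible q → S.BlockDiagDominant q ∧ S.MMatrixCond q)
    (bl bu : Fin N × Fin C → ℝ) (hle : ∀ v, bl v ≤ bu v)
    (hsub : ∀ v : Fin N × Fin C, 0 ≤ bl v ∧ (bu v : EReal) ≤ S.b v.1 v.2)
    (hup : ∀ v : Fin N × Fin C, ∀ q ∈ Set.Icc bl bu, q v = bu v → S.f q v.1 v.2 ≤ 0)
    (hlo : ∀ v : Fin N × Fin C, ∀ q ∈ Set.Icc bl bu, q v = bl v → 0 ≤ S.f q v.1 v.2) :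
    ∃ q ∈ Set.Icc bl bu, (∀ i ℓ, S.f q i ℓ = 0) ∧
      (∀ q', S.Feasible q' → (∀ i ℓ, S.f q' i ℓ = 0) → q' = q) ∧
      (∀ z : ℂ, ((S.jacobian q).map (fun x : ℝ => (x : ℂ))).charpoly.IsRoot z →
        z.re < 0) := by
  set F : (Fin N × Fin C → ℝ) → Fin N × Fin C → ℝ := fun q v => S.f q v.1 v.2 with hF
  have hcont : Continuous F :=
    continuous_iff_continuousAt.2 fun y => (S.aux_hasFDeriv y).continuousAt
  have hK : ∀ x ∈ {q | S.Feasible q}, ∀ y ∈ {q | S.Feasible q},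
      Set.uIcc x y ⊆ {q | S.Feasible q} := by
    intro x hx y hy z hz i ℓ
    have h1 : min (x (i, ℓ)) (y (i, ℓ)) ≤ z (i, ℓ) := hz.1 (i, ℓ)
    have h2 : z (i, ℓ) ≤ max (x (i, ℓ)) (y (i, ℓ)) := hz.2 (i, ℓ)
    refine ⟨(le_min (hx i ℓ).1 (hy i ℓ).1).trans h1, ?_⟩
    rcases le_max_iff.1 h2 with h3 | h3
    · exact (EReal.coe_le_coe_iff.2 h3).trans (hx i ℓ).2
    · exact (EReal.coe_le_coe_iff.2 h3).trans (hy i ℓ).2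
  have hPf : ∀ x, S.Feasible x → ∀ y, S.Feasible y → x ≠ y →
      ∃ i, (x i - y i) * (F x i - F y i) < 0 := by
    intro x hx y hy hne
    obtain ⟨i, hi⟩ := aux_pfun (fun q => - F q) (fun q => - S.jacobian q) {q | S.Feasible q} hK
      (fun y => by
        have := (S.aux_hasFDeriv y).neg
        refine this.congr_fderiv ?_
        refine ContinuousLinearMap.ext fun w => ?_
        ext a
        simp [Matrix.neg_mulVec])
      (fun q hq v hv => by
        obtain ⟨a, ha⟩ := S.aux_key q (h q hq).1 (h q hq).2 (fun b => (v b : ℂ)) (by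
          intro h0
          apply hv
          ext b
          simpa using congrFun h0 b)
        refine ⟨a, ?_⟩
        rw [Complex.conj_ofReal, Complex.re_ofReal_mul, Complex.re_sum] at ha
        simp only [Complex.re_ofReal_mul, Complex.ofReal_re] at ha
        rw [Matrix.neg_mulVec, Pi.neg_apply]
        simp only [Matrix.mulVec, dotProduct]
        linarith)
      _ x hx y hy le_rfl hne
    refine ⟨i, ?_⟩
    simp only [Pi.neg_apply] at hi
    linarith
  have hbox : ∀ q ∈ Set.Icc bl bu, S.Feasible q := by
    intro q hq i ℓ
    exact ⟨(hsub (i, ℓ)).1.trans (hq.1 _),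
      (EReal.coe_le_coe_iff.2 (hq.2 (i, ℓ))).trans (hsub (i, ℓ)).2⟩
  obtain ⟨q, hq, -, hz⟩ := aux_exists F hcont bl bu hle hup hlo
    (fun x hx y hy hne => hPf x (hbox x hx) y (hbox y hy) hne) Finset.univ bl ⟨le_rfl, hle⟩
  refine ⟨q, hq, fun i ℓ => hz (i, ℓ) (Finset.mem_univ _), ?_, ?_⟩
  · intro q' hq' h0
    by_contra hne
    obtain ⟨v, hv⟩ := hPf q' hq' q (hbox q hq) hne
    have h1 : F q' v = 0 := h0 v.1 v.2
    rw [h1, hz v (Finset.mem_univ _)] at hv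
    simp at hv
  · intro z hzr
    rw [Polynomial.IsRoot, Matrix.eval_charpoly] at hzr
    obtain ⟨v, hv, hzv⟩ := Matrix.exists_mulVec_eq_zero_iff.2 hzr
    obtain ⟨a, ha⟩ := S.aux_key q (h q (hbox q hq)).1 (h q (hbox q hq)).2 v hv
    have h1 : ∑ b, (S.jacobian q a b : ℂ) * v b = z * v a := by
      have := congrFun hzv a
      rw [Matrix.sub_mulVec, Pi.sub_apply, Pi.zero_apply, sub_eq_zero] at this
      simp only [Matrix.scalar_apply, Matrix.mulVec_diagonal] at this
      rw [this]
      rfl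
    rw [h1] at ha
    have h2 : (starRingEnd ℂ) (v a) * (z * v a) = ((Complex.normSq (v a) : ℝ) : ℂ) * z := by
      rw [Complex.normSq_eq_conj_mul_self]; ring
    rw [h2, Complex.re_ofReal_mul] at ha
    by_contra hre
    push Not at hre
    have := mul_nonneg (Complex.normSq_nonneg (v a)) hre
    linarith
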